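/- Semiclassical limit error estimate (Theorem 1.2): let ħ > 0 and let V : ℝ → ℝ be of class C⁴ with ‖V⁽ⁿ⁾‖_∞ < ∞ for n = 2,3,4. Let R^ħ be a strong solution of the von Neumann equation in Weyl variables and let 𝒮 be a strong solution of the semiclassical equation. Then for every t ≥ 0, ‖R^ħ(t) − 𝒮(t)‖_{L²(ℝ²)} ≤ ‖R^ħ(0) − 𝒮(0)‖_{L²(ℝ²)} + (ħ²/24) ‖V⁽³⁾‖_∞ ((e^{C₃[V]t} − 1)/C₃[V]) 𝒩₃(0), where 𝒩₃ is the weighted norm applied to 𝒮 and C₃[V] = 3² + 2·3 + 3‖V''‖_∞ + 3|V'(0)| + 2³·(1+3)·3· max_{2 ≤ n ≤ 4} ‖V⁽ⁿ⁾‖_∞. -/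

import Mathlib

open MeasureTheory

noncomputable section

/-- Mixed partial derivative `∂_x^b ∂_y^β` of a function `f(x,y)`. -/
def pd2 (b β : ℕ) (f : ℝ → ℝ → ℂ) (x y : ℝ) : ℂ :=
  iteratedDeriv b (fun x' => iteratedDeriv β (fun y' => f x' y') y) x

/-- Weighted derivative `x^a ∂_x^b y^α ∂_y^β` of `f(x,y)`. -/
def wD (a b α β : ℕ) (f : ℝ → ℝ → ℂ) (x y : ℝ) : ℂ :=
  (x : ℂ) ^ a * (y : ℂ) ^ α * pd2 b β f x y

/-- Uncurried version of a two-variable function. -/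
def unc (f : ℝ → ℝ → ℂ) : ℝ × ℝ → ℂ := fun p => f p.1 p.2

/-- L² norm over ℝ². -/
def L2 (f : ℝ → ℝ → ℂ) : ℝ := (eLpNorm (unc f) 2 (volume : Measure (ℝ × ℝ))).toReal

/-- L² norm over ℝ. -/
def L2one (f : ℝ → ℂ) : ℝ := (eLpNorm f 2 (volume : Measure ℝ)).toReal

/-- Schwartz-class predicate for smooth functions of two real variables. -/
def IsSchwartz2 (f : ℝ → ℝ → ℂ) : Prop :=
  ContDiff ℝ (⊤ : ℕ∞) (unc f) ∧
    ∀ k n : ℕ, ∃ C : ℝ, ∀ p : ℝ × ℝ, ‖p‖ ^ k * ‖iteratedFDeriv ℝ n (unc f) p‖ ≤ C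

/-- Schwartz-class predicate for smooth functions of one real variable. -/
def IsSchwartz1 (f : ℝ → ℂ) : Prop :=
  ContDiff ℝ (⊤ : ℕ∞) f ∧ ∀ k n : ℕ, ∃ C : ℝ, ∀ x : ℝ, |x| ^ k * ‖iteratedDeriv n f x‖ ≤ C

/-- Time derivative of a time-dependent two-variable function. -/
def dtR (R : ℝ → ℝ → ℝ → ℂ) (t x y : ℝ) : ℂ := deriv (fun s => R s x y) t

/-- For all `a b α β`, the map `t ↦ x^a ∂_x^b y^α ∂_y^β R(t,·,·)` is continuously
differentiable from `[0,∞)` into `L²(ℝ²)` with derivative `x^a ∂_x^b y^α ∂_y^β ∂_t R(t,·,·)`. -/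
def C1intoL2 (R : ℝ → ℝ → ℝ → ℂ) : Prop :=
  ∀ a b α β : ℕ, ∃ Ψ Ψ' : ℝ → Lp ℂ 2 (volume : Measure (ℝ × ℝ)),
    (∀ t : ℝ, 0 ≤ t → (Ψ t : ℝ × ℝ → ℂ) =ᵐ[volume] unc (wD a b α β (R t))) ∧
    (∀ t : ℝ, 0 ≤ t → (Ψ' t : ℝ × ℝ → ℂ) =ᵐ[volume] unc (wD a b α β (dtR R t))) ∧
    (∀ t : ℝ, 0 ≤ t → HasDerivWithinAt Ψ (Ψ' t) (Set.Ici 0) t) ∧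
    ContinuousOn Ψ' (Set.Ici 0)

/-- Regularity part of the notion of strong solution on `[0,∞) × ℝ²`. -/
def IsRegularSol (R : ℝ → ℝ → ℝ → ℂ) : Prop :=
  ContDiffOn ℝ (⊤ : ℕ∞) (fun p : ℝ × ℝ × ℝ => R p.1 p.2.1 p.2.2) {p : ℝ × ℝ × ℝ | 0 ≤ p.1} ∧
  (∀ t : ℝ, 0 ≤ t → IsSchwartz2 (R t)) ∧ C1intoL2 R

/-- Strong solution of the von Neumann equation in Weyl variables. -/
def IsVNSol (hbar : ℝ) (V : ℝ → ℝ) (R : ℝ → ℝ → ℝ → ℂ) : Prop :=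
  IsRegularSol R ∧
  ∀ t : ℝ, 0 ≤ t → ∀ x y : ℝ,
    dtR R t x y = Complex.I * pd2 1 1 (R t) x y -
      Complex.I * (((V (x + hbar * y / 2) - V (x - hbar * y / 2)) / hbar : ℝ) : ℂ) * R t x y

/-- Strong solution of the semiclassical equation. -/
def IsSCSol (V : ℝ → ℝ) (R : ℝ → ℝ → ℝ → ℂ) : Prop :=
  IsRegularSol R ∧
  ∀ t : ℝ, 0 ≤ t → ∀ x y : ℝ,
    dtR R t x y = Complex.I * pd2 1 1 (R t) x y -
      Complex.I * ((deriv V x * y : ℝ) : ℂ) * R t x y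

/-- The weighted Sobolev functional `𝒩_m` applied to a function of `(x,y)`. -/
def NN (m : ℕ) (f : ℝ → ℝ → ℂ) : ℝ :=
  ∑ q ∈ Finset.filter
      (fun q : ℕ × ℕ × ℕ × ℕ => q.1 + q.2.1 + q.2.2.1 + q.2.2.2 ≤ m)
      (Finset.range (m+1) ×ˢ Finset.range (m+1) ×ˢ Finset.range (m+1) ×ˢ Finset.range (m+1)),
    L2 (wD q.1 q.2.1 q.2.2.1 q.2.2.2 f)

/-- Supremum norm of a real-valued function. -/
def supN (f : ℝ → ℝ) : ℝ := ⨆ x : ℝ, |f x|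

/-- The constant `C_m[V]`. -/
def CmV (m : ℕ) (V : ℝ → ℝ) : ℝ :=
  ((m : ℝ)^2 + 2*m + m * supN (iteratedDeriv 2 V) + m * |deriv V 0|) +
    2^m * (1+m) * m * (⨆ n ∈ Finset.Icc 2 (m+1), supN (iteratedDeriv n V))

/-- Physicists' Hermite polynomial. -/
def Hpoly (k : ℕ) (y : ℝ) : ℝ :=
  (-1)^k * Real.exp (y^2) * iteratedDeriv k (fun z => Real.exp (-z^2)) y

/-- Hermite function `Φ_k`. -/
def Φh (k : ℕ) (y : ℝ) : ℝ :=
  ((2:ℝ)^k * (Nat.factorial k : ℝ) * Real.sqrt Real.pi) ^ (-(1:ℝ)/2) *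
    Real.exp (-y^2/2) * Hpoly k y

/-- The operator `𝒟 u = ∂_x u + V'(x) u`. -/
def Dop (V : ℝ → ℝ) (u : ℝ → ℂ) (x : ℝ) : ℂ := deriv u x + ((deriv V x : ℝ) : ℂ) * u x

/-- The operator `𝒟* u = −∂_x u + V'(x) u`. -/
def Dstar (V : ℝ → ℝ) (u : ℝ → ℂ) (x : ℝ) : ℂ := -deriv u x + ((deriv V x : ℝ) : ℂ) * u x

/-- The quantum correction `ℰ^ħ(x,y)`. -/
def Eh (hbar : ℝ) (V : ℝ → ℝ) (x y : ℝ) : ℝ :=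
  (V (x + hbar * y / 2) - V (x - hbar * y / 2)) / hbar - deriv V x * y

/-- Matrix elements `ℰ^ħ_{k,l}(x)` of the quantum correction. -/
def Ekl (hbar : ℝ) (V : ℝ → ℝ) (k l : ℕ) (x : ℝ) : ℝ :=
  ∫ y : ℝ, Eh hbar V x y * Φh k y * Φh l y

/-- `t ↦ u(t,·)` is continuously differentiable from `[0,∞)` into `L²(ℝ)` with
derivative `∂_t u`. -/
def C1intoL2one (u : ℝ → ℝ → ℂ) : Prop :=
  ∃ Ψ Ψ' : ℝ → Lp ℂ 2 (volume : Measure ℝ),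
    (∀ t : ℝ, 0 ≤ t → (Ψ t : ℝ → ℂ) =ᵐ[volume] u t) ∧
    (∀ t : ℝ, 0 ≤ t → (Ψ' t : ℝ → ℂ) =ᵐ[volume] fun x => deriv (fun s => u s x) t) ∧
    (∀ t : ℝ, 0 ≤ t → HasDerivWithinAt Ψ (Ψ' t) (Set.Ici 0) t) ∧
    ContinuousOn Ψ' (Set.Ici 0)

/-- Regularity part of the notion of strong solution of a Hermite–Galerkin system of size `N`;
the convention `R_k = 0` for `k > N` is included. -/
def IsGalerkinReg (N : ℕ) (R : ℕ → ℝ → ℝ → ℂ) : Prop :=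
  (∀ k, k ≤ N → ContDiffOn ℝ (⊤ : ℕ∞) (fun p : ℝ × ℝ => R k p.1 p.2) {p : ℝ × ℝ | 0 ≤ p.1}) ∧
  (∀ k, k ≤ N → ∀ t : ℝ, 0 ≤ t → IsSchwartz1 (R k t)) ∧
  (∀ k, k ≤ N → C1intoL2one (R k)) ∧
  (∀ k, N < k → ∀ t x : ℝ, R k t x = 0)

/-- Strong solution of the semiclassical Hermite–Galerkin system of size `N`.
(For `k = 0` the coefficient `√(k/2)` vanishes, so the term `R_{k-1}` is harmless.) -/
def IsSCGalerkinSol (V : ℝ → ℝ) (N : ℕ) (R : ℕ → ℝ → ℝ → ℂ) : Prop :=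
  IsGalerkinReg N R ∧
  ∀ k, k ≤ N → ∀ t : ℝ, 0 ≤ t → ∀ x : ℝ,
    deriv (fun s => R k s x) t +
      Complex.I * ((Real.sqrt ((k : ℝ)/2) : ℂ) * Dop V (R (k-1) t) x +
        (Real.sqrt (((k : ℝ)+1)/2) : ℂ) * Dstar V (R (k+1) t) x) = 0

/-- Strong solution of the von Neumann Hermite–Galerkin system of size `N`. -/
def IsVNGalerkinSol (hbar : ℝ) (V : ℝ → ℝ) (N : ℕ) (R : ℕ → ℝ → ℝ → ℂ) : Prop :=
  IsGalerkinReg N R ∧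
  ∀ k, k ≤ N → ∀ t : ℝ, 0 ≤ t → ∀ x : ℝ,
    deriv (fun s => R k s x) t +
      Complex.I * ((Real.sqrt ((k : ℝ)/2) : ℂ) * Dop V (R (k-1) t) x +
        (Real.sqrt (((k : ℝ)+1)/2) : ℂ) * Dstar V (R (k+1) t) x) =
      -Complex.I * ∑ l ∈ Finset.range (N+1), ((Ekl hbar V k l x : ℝ) : ℂ) * R l t x

/-- Smooth potential with all derivatives of order `≥ 2` bounded. -/
def SmoothBounded (V : ℝ → ℝ) : Prop :=
  ContDiff ℝ (⊤ : ℕ∞) V ∧ ∀ n : ℕ, 2 ≤ n → ∃ C : ℝ, ∀ x : ℝ, |iteratedDeriv n V x| ≤ C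

/-- The harmonic-oscillator operator `A G = y² G − G''`. -/
def Aop (g : ℝ → ℂ) : ℝ → ℂ := fun y => (y : ℂ)^2 * g y - iteratedDeriv 2 g y

open scoped LineDeriv SchwartzMap InnerProductSpace

section Energy

lemma norm_le_sqrt_norm_sq_add {E : Type*} [NormedAddCommGroup E] (x : E) (ε : ℝ) :
    ‖x‖ ≤ √(‖x‖ ^ 2 + ε ^ 2) :=
  Real.le_sqrt_of_sq_le (by nlinarith [sq_nonneg ε])

lemma sqrt_norm_sq_add_le {E : Type*} [NormedAddCommGroup E] (x : E) {ε : ℝ} (hε : 0 ≤ ε) :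
    √(‖x‖ ^ 2 + ε ^ 2) ≤ ‖x‖ + ε :=
  Real.sqrt_le_iff.2 ⟨by positivity, by nlinarith [mul_nonneg (norm_nonneg x) hε]⟩

variable {H : Type*} [NormedAddCommGroup H] [InnerProductSpace ℝ H]

/-- The regularised norm `√(‖u‖² + ε²)` is differentiable along a differentiable curve, and an
energy inequality for `u` controls its derivative. -/
lemma exists_hasDerivWithinAt_sqrt_norm_sq_add {u : ℝ → H} {v : H} {s : Set ℝ} {t g ε : ℝ}
    (hε : 0 < ε) (hu : HasDerivWithinAt u v s t) (hg : 0 ≤ g) (h : ⟪u t, v⟫_ℝ ≤ ‖u t‖ * g) :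
    ∃ d ≤ g, HasDerivWithinAt (fun r => √(‖u r‖ ^ 2 + ε ^ 2)) d s t := by
  have hpos : 0 < ‖u t‖ ^ 2 + ε ^ 2 := by positivity
  refine ⟨_, ?_, (hu.norm_sq.add_const (ε ^ 2)).sqrt hpos.ne'⟩
  have hle : ‖u t‖ ≤ √(‖u t‖ ^ 2 + ε ^ 2) := Real.le_sqrt_of_sq_le (by nlinarith [sq_nonneg ε])
  have hs : 0 < √(‖u t‖ ^ 2 + ε ^ 2) := Real.sqrt_pos.2 hpos
  rw [div_le_iff₀ (by positivity)]
  nlinarith [mul_le_mul_of_nonneg_right hle hg]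

/-- A function on `[0,∞)` with nonpositive derivative stays below its initial value. -/
lemma le_initial_of_hasDerivWithinAt_nonpos {f : ℝ → ℝ}
    (h : ∀ t, 0 ≤ t → ∃ d ≤ 0, HasDerivWithinAt f d (Set.Ici 0) t) {t : ℝ} (ht : 0 ≤ t) :
    f t ≤ f 0 := by
  refine antitoneOn_of_deriv_nonpos (convex_Ici (0 : ℝ)) (f := f) ?_ ?_ ?_
    (Set.mem_Ici.2 le_rfl) (Set.mem_Ici.2 ht) ht
  · intro s hs
    obtain ⟨d, -, hd⟩ := h s hs
    exact hd.continuousWithinAt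
  · intro s hs
    rw [interior_Ici] at hs ⊢
    obtain ⟨d, -, hd⟩ := h s (le_of_lt hs)
    exact (hd.hasDerivAt (Ici_mem_nhds hs)).differentiableAt.differentiableWithinAt
  · intro s hs
    rw [interior_Ici] at hs
    obtain ⟨d, hd0, hd⟩ := h s (le_of_lt hs)
    rw [(hd.hasDerivAt (Ici_mem_nhds hs)).deriv]
    exact hd0

/-- Grönwall's inequality for the sum of the norms of finitely many curves satisfying coupled energy
inequalities. -/
lemma sum_norm_le_exp_mul {ι : Type*} (I : Finset ι) (u u' : ι → ℝ → H) (g : ι → ℝ → ℝ) {C : ℝ}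
    (hC : 0 ≤ C)
    (hu : ∀ i ∈ I, ∀ t, 0 ≤ t → HasDerivWithinAt (u i) (u' i t) (Set.Ici 0) t)
    (hg : ∀ i ∈ I, ∀ t, 0 ≤ t → 0 ≤ g i t)
    (hug : ∀ i ∈ I, ∀ t, 0 ≤ t → ⟪u i t, u' i t⟫_ℝ ≤ ‖u i t‖ * g i t)
    (hsum : ∀ t, 0 ≤ t → ∑ i ∈ I, g i t ≤ C * ∑ i ∈ I, ‖u i t‖) {t : ℝ} (ht : 0 ≤ t) :
    ∑ i ∈ I, ‖u i t‖ ≤ Real.exp (C * t) * ∑ i ∈ I, ‖u i 0‖ := by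
  have key : ∀ ε : ℝ, 0 < ε →
      ∑ i ∈ I, ‖u i t‖ ≤ Real.exp (C * t) * ∑ i ∈ I, (‖u i 0‖ + ε) := by
    intro ε hε
    have hmono : Real.exp (-(C * t)) * ∑ i ∈ I, √(‖u i t‖ ^ 2 + ε ^ 2)
        ≤ Real.exp (-(C * 0)) * ∑ i ∈ I, √(‖u i 0‖ ^ 2 + ε ^ 2) := by
      refine le_initial_of_hasDerivWithinAt_nonpos
        (f := fun t => Real.exp (-(C * t)) * ∑ i ∈ I, √(‖u i t‖ ^ 2 + ε ^ 2)) ?_ ht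
      intro s hs
      choose! d hdg hd using fun i (hi : i ∈ I) => exists_hasDerivWithinAt_sqrt_norm_sq_add hε
        (hu i hi s hs) (hg i hi s hs) (hug i hi s hs)
      have he : HasDerivWithinAt (fun t => Real.exp (-(C * t))) (Real.exp (-(C * s)) * -(C * 1))
          (Set.Ici 0) s := (((hasDerivAt_id s).const_mul C).neg.exp).hasDerivWithinAt
      refine ⟨_, ?_, he.mul (HasDerivWithinAt.fun_sum hd)⟩
      have h1 : ∑ i ∈ I, d i ≤ C * ∑ i ∈ I, √(‖u i s‖ ^ 2 + ε ^ 2) :=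
        (Finset.sum_le_sum hdg).trans <| (hsum s hs).trans <| mul_le_mul_of_nonneg_left
          (Finset.sum_le_sum fun i _ => norm_le_sqrt_norm_sq_add _ _) hC
      nlinarith [mul_le_mul_of_nonneg_left h1 (Real.exp_pos (-(C * s))).le]
    have h2 : ∑ i ∈ I, √(‖u i t‖ ^ 2 + ε ^ 2)
        ≤ Real.exp (C * t) * ∑ i ∈ I, √(‖u i 0‖ ^ 2 + ε ^ 2) := by
      have := mul_le_mul_of_nonneg_left hmono (Real.exp_pos (C * t)).le
      rwa [← mul_assoc, ← Real.exp_add, add_neg_cancel, mul_zero, neg_zero, Real.exp_zero, one_mul,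
        one_mul] at this
    exact (Finset.sum_le_sum fun i _ => norm_le_sqrt_norm_sq_add _ _).trans <| h2.trans <|
      mul_le_mul_of_nonneg_left (Finset.sum_le_sum fun i _ => sqrt_norm_sq_add_le _ hε.le)
        (Real.exp_pos _).le
  have hlim : Filter.Tendsto (fun ε : ℝ => Real.exp (C * t) * ∑ i ∈ I, (‖u i 0‖ + ε))
      (nhdsWithin 0 (Set.Ioi 0)) (nhds (Real.exp (C * t) * ∑ i ∈ I, (‖u i 0‖ + 0))) :=
    (Continuous.tendsto (by fun_prop) 0).mono_left nhdsWithin_le_nhds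
  simp only [add_zero] at hlim
  exact ge_of_tendsto hlim (by filter_upwards [self_mem_nhdsWithin] with ε hε using key ε hε)

/-- Duhamel estimate for a curve whose energy is fed by an exponentially growing source. -/
lemma norm_le_add_of_inner_le_exp {u u' : ℝ → H} {C K : ℝ} (hC : 0 < C) (hK : 0 ≤ K)
    (hu : ∀ t, 0 ≤ t → HasDerivWithinAt u (u' t) (Set.Ici 0) t)
    (h : ∀ t, 0 ≤ t → ⟪u t, u' t⟫_ℝ ≤ ‖u t‖ * (K * Real.exp (C * t))) {t : ℝ} (ht : 0 ≤ t) :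
    ‖u t‖ ≤ ‖u 0‖ + K * ((Real.exp (C * t) - 1) / C) := by
  have key : ∀ ε : ℝ, 0 < ε → ‖u t‖ ≤ ‖u 0‖ + K * ((Real.exp (C * t) - 1) / C) + ε := by
    intro ε hε
    have hmono := le_initial_of_hasDerivWithinAt_nonpos
      (f := fun t => √(‖u t‖ ^ 2 + ε ^ 2) - K * ((Real.exp (C * t) - 1) / C)) (fun s hs => by
        obtain ⟨d, hd, hd'⟩ := exists_hasDerivWithinAt_sqrt_norm_sq_add hε (hu s hs)
          (by positivity) (h s hs)
        have he : HasDerivWithinAt (fun t => K * ((Real.exp (C * t) - 1) / C))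
            (K * ((Real.exp (C * s) * (C * 1)) / C)) (Set.Ici 0) s :=
          (((((hasDerivAt_id s).const_mul C).exp.sub_const 1).div_const C).const_mul
            K).hasDerivWithinAt
        refine ⟨_, ?_, hd'.sub he⟩
        have : K * ((Real.exp (C * s) * (C * 1)) / C) = K * Real.exp (C * s) := by
          field_simp
        linarith) ht
    have h1 := norm_le_sqrt_norm_sq_add (u t) ε
    have h2 := sqrt_norm_sq_add_le (u 0) hε.le
    simp only [mul_zero, Real.exp_zero, sub_self, zero_div, sub_zero] at hmono
    linarith
  exact le_of_forall_pos_le_add key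

end Energy

section SchwartzPlane

/-- Partial derivative in the first variable, on Schwartz functions of the plane. -/
def derivX (f : 𝓢(ℝ × ℝ, ℂ)) : 𝓢(ℝ × ℝ, ℂ) := ∂_{((1 : ℝ), (0 : ℝ))} f

/-- Partial derivative in the second variable, on Schwartz functions of the plane. -/
def derivY (f : 𝓢(ℝ × ℝ, ℂ)) : 𝓢(ℝ × ℝ, ℂ) := ∂_{((0 : ℝ), (1 : ℝ))} f

/-- Multiplication by the second variable, on Schwartz functions of the plane. -/
def mulY (f : 𝓢(ℝ × ℝ, ℂ)) : 𝓢(ℝ × ℝ, ℂ) :=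
  SchwartzMap.smulLeftCLM ℂ (ContinuousLinearMap.snd ℝ ℝ ℝ) f

lemma mulY_apply (f : 𝓢(ℝ × ℝ, ℂ)) (p : ℝ × ℝ) : mulY f p = (p.2 : ℂ) * f p := by
  rw [mulY, SchwartzMap.smulLeftCLM_apply_apply
    (ContinuousLinearMap.snd ℝ ℝ ℝ).hasTemperateGrowth]
  simp

lemma mulY_iterate_apply (n : ℕ) (f : 𝓢(ℝ × ℝ, ℂ)) (p : ℝ × ℝ) :
    (mulY^[n] f) p = (p.2 : ℂ) ^ n * f p := by
  induction n with
  | zero => simp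
  | succ n ih => rw [Function.iterate_succ_apply', mulY_apply, ih]; ring

lemma hasDerivAt_slice_fst (f : 𝓢(ℝ × ℝ, ℂ)) (x y : ℝ) :
    HasDerivAt (fun x' => f (x', y)) (derivX f (x, y)) x := by
  have h : HasDerivAt (fun x' : ℝ => (x', y)) ((1 : ℝ), (0 : ℝ)) x :=
    (hasDerivAt_id x).prodMk (hasDerivAt_const x y)
  exact (f.hasFDerivAt (x, y)).comp_hasDerivAt x h

lemma hasDerivAt_slice_snd (f : 𝓢(ℝ × ℝ, ℂ)) (x y : ℝ) :
    HasDerivAt (fun y' => f (x, y')) (derivY f (x, y)) y := by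
  have h : HasDerivAt (fun y' : ℝ => (x, y')) ((0 : ℝ), (1 : ℝ)) y :=
    (hasDerivAt_const y x).prodMk (hasDerivAt_id y)
  exact (f.hasFDerivAt (x, y)).comp_hasDerivAt y h

lemma iteratedDeriv_slice_fst (n : ℕ) (f : 𝓢(ℝ × ℝ, ℂ)) (x y : ℝ) :
    iteratedDeriv n (fun x' => f (x', y)) x = (derivX^[n] f) (x, y) := by
  induction n generalizing f x with
  | zero => simp
  | succ n ih =>
    have h : deriv (fun x' => f (x', y)) = fun x' => derivX f (x', y) :=
      funext fun x' => (hasDerivAt_slice_fst f x' y).deriv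
    rw [iteratedDeriv_succ', h, ih, Function.iterate_succ_apply]

lemma contDiff_slice_fst (f : 𝓢(ℝ × ℝ, ℂ)) (n : ℕ∞) (y : ℝ) :
    ContDiff ℝ n (fun x' => f (x', y)) :=
  (f.smooth n).comp (contDiff_id.prodMk contDiff_const)

lemma derivX_derivY (f : 𝓢(ℝ × ℝ, ℂ)) : derivX (derivY f) = derivY (derivX f) := by
  ext p
  have hd : DifferentiableAt ℝ (fderiv ℝ f) p :=
    ((f.smooth 2).fderiv_right (m := 1) (by norm_num)).differentiable (by norm_num) p
  have h (v w : ℝ × ℝ) : (∂_{v} (∂_{w} f) : 𝓢(ℝ × ℝ, ℂ)) p = fderiv ℝ (fderiv ℝ f) p v w := by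
    have hw : ⇑(∂_{w} f : 𝓢(ℝ × ℝ, ℂ)) = fun q => fderiv ℝ f q w := rfl
    rw [SchwartzMap.lineDerivOp_apply_eq_fderiv, hw,
      fderiv_clm_apply hd (differentiableAt_const w)]
    simp
  have hsymm : IsSymmSndFDerivAt ℝ f p := (f.smooth 2).contDiffAt.isSymmSndFDerivAt (by simp)
  simp only [derivX, derivY, h]
  exact hsymm _ _

lemma derivX_mulY_iterate (n : ℕ) (f : 𝓢(ℝ × ℝ, ℂ)) :
    derivX (mulY^[n] f) = mulY^[n] (derivX f) := by
  ext ⟨x, y⟩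
  have h := (hasDerivAt_slice_fst f x y).const_mul ((y : ℂ) ^ n)
  have h' := hasDerivAt_slice_fst (mulY^[n] f) x y
  simp only [mulY_iterate_apply] at h' ⊢
  exact h'.unique h

lemma derivY_mulY_iterate_apply (n : ℕ) (f : 𝓢(ℝ × ℝ, ℂ)) (x y : ℝ) :
    derivY (mulY^[n] f) (x, y) =
      (y : ℂ) ^ n * derivY f (x, y) + n * (y : ℂ) ^ (n - 1) * f (x, y) := by
  have hy : HasDerivAt (fun y' : ℝ => (y' : ℂ) ^ n) (n * (y : ℂ) ^ (n - 1)) y := by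
    simpa using (Complex.ofRealCLM.hasDerivAt (x := y)).fun_pow n
  have h := hy.mul (hasDerivAt_slice_snd f x y)
  have h' := hasDerivAt_slice_snd (mulY^[n] f) x y
  simp only [mulY_iterate_apply] at h'
  rw [h'.unique h]
  ring

/-- `y^α ∂_x^b` on Schwartz functions of the plane. -/
def weightedX (α b : ℕ) (f : 𝓢(ℝ × ℝ, ℂ)) : 𝓢(ℝ × ℝ, ℂ) := mulY^[α] (derivX^[b] f)

lemma weightedX_apply (α b : ℕ) (f : 𝓢(ℝ × ℝ, ℂ)) (x y : ℝ) :
    weightedX α b f (x, y) = (y : ℂ) ^ α * (derivX^[b] f) (x, y) :=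
  mulY_iterate_apply _ _ _

lemma derivX_derivY_weightedX_apply (α b : ℕ) (f : 𝓢(ℝ × ℝ, ℂ)) (x y : ℝ) :
    derivX (derivY (weightedX α b f)) (x, y) =
      (y : ℂ) ^ α * (derivX^[b] (derivX (derivY f))) (x, y) +
        α * weightedX (α - 1) (b + 1) f (x, y) := by
  have h : derivX^[b] (derivX (derivY f)) = derivY (derivX^[b + 1] f) := by
    rw [← Function.iterate_succ_apply]
    exact (Function.Commute.iterate_left (f := derivX) (g := derivY) derivX_derivY (b + 1)) f
  rw [derivX_derivY, weightedX, derivX_mulY_iterate, derivY_mulY_iterate_apply, h,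
    weightedX_apply, Function.iterate_succ_apply']
  ring

/-- The operator `i ∂_x ∂_y` is skew-adjoint for the real `L²` inner product. -/
lemma integral_inner_I_mul_derivX_derivY (f : 𝓢(ℝ × ℝ, ℂ)) :
    ∫ p, ⟪f p, Complex.I * derivX (derivY f) p⟫_ℝ = 0 := by
  let L : ℂ →L[ℝ] ℂ →L[ℝ] ℝ :=
    (((innerSL ℝ).flip).comp (ContinuousLinearMap.mul ℝ ℂ Complex.I)).flip
  have hL (u v : ℂ) : L u v = ⟪u, Complex.I * v⟫_ℝ := rfl
  have hanti (u v : ℂ) : L u v = - L v u := by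
    simp only [hL, Complex.inner]; simp; ring
  have h1 := SchwartzMap.integral_bilinear_lineDerivOp_right_eq_neg_left (μ := volume)
    f (derivY f) L ((1 : ℝ), (0 : ℝ))
  have h2 := SchwartzMap.integral_bilinear_lineDerivOp_right_eq_neg_left (μ := volume)
    f (derivX f) L ((0 : ℝ), (1 : ℝ))
  change ∫ p, L (f p) (derivX (derivY f) p) = -∫ p, L (derivX f p) (derivY f p) at h1
  change ∫ p, L (f p) (derivY (derivX f) p) = -∫ p, L (derivY f p) (derivX f p) at h2
  have h3 : ∫ p, L (derivX f p) (derivY f p) = - ∫ p, L (derivY f p) (derivX f p) := by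
    rw [← integral_neg]
    exact integral_congr_ae (Filter.Eventually.of_forall fun p => hanti _ _)
  rw [← derivX_derivY] at h2
  simp only [← hL]
  linarith

lemma integral_norm_mul_norm_le (f g : 𝓢(ℝ × ℝ, ℂ)) :
    ∫ p, ‖f p‖ * ‖g p‖ ≤ ‖f.toLp 2‖ * ‖g.toLp 2‖ := by
  have hf := (f.memLp 2).norm
  have hg := (g.memLp 2).norm
  have h := real_inner_le_norm (hf.toLp _) (hg.toLp _)
  rw [Lp.norm_toLp, Lp.norm_toLp, eLpNorm_norm, eLpNorm_norm, ← SchwartzMap.norm_toLp,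
    ← SchwartzMap.norm_toLp, L2.inner_def] at h
  refine le_of_eq_of_le (integral_congr_ae ?_) h
  filter_upwards [hf.coeFn_toLp, hg.coeFn_toLp] with p h1 h2
  rw [h1, h2]
  simp [mul_comm]

lemma integrable_norm_mul_norm (f g : 𝓢(ℝ × ℝ, ℂ)) : Integrable (fun p => ‖f p‖ * ‖g p‖) :=
  (f.memLp 2).norm.integrable_mul (g.memLp 2).norm

lemma integrable_inner_I_mul (f g : 𝓢(ℝ × ℝ, ℂ)) :
    Integrable (fun p => ⟪f p, Complex.I * g p⟫_ℝ) := by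
  refine (integrable_norm_mul_norm f g).mono' ?_ (Filter.Eventually.of_forall fun p => ?_)
  · exact (f.continuous.inner (continuous_const.mul g.continuous)).aestronglyMeasurable
  · simpa using norm_inner_le_norm (𝕜 := ℝ) (f p) (Complex.I * g p)

/-- Energy inequality for the generator `i ∂_x ∂_y − i w` with a real multiplier `w` and a source
term dominated by Schwartz functions. -/
lemma inner_le_of_ae_eq_generator {κ : Type*} (J : Finset κ) (f : 𝓢(ℝ × ℝ, ℂ))
    (h : κ → 𝓢(ℝ × ℝ, ℂ)) (c : κ → ℝ) (hc : ∀ j ∈ J, 0 ≤ c j) (w : ℝ × ℝ → ℝ) (F : ℝ × ℝ → ℂ)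
    (u u' : Lp ℂ 2 (volume : Measure (ℝ × ℝ))) (hu : u =ᵐ[volume] f)
    (hu' : u' =ᵐ[volume] fun p =>
      Complex.I * derivX (derivY f) p - Complex.I * (w p : ℂ) * f p + F p)
    (hF : ∀ p, ‖F p‖ ≤ ∑ j ∈ J, c j * ‖h j p‖) :
    ⟪u, u'⟫_ℝ ≤ ‖u‖ * ∑ j ∈ J, c j * ‖(h j).toLp 2‖ := by
  have hnorm : ‖u‖ = ‖f.toLp 2‖ := by
    rw [Lp.norm_def, SchwartzMap.norm_toLp, eLpNorm_congr_ae hu]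
  have hi1 := integrable_inner_I_mul f (derivX (derivY f))
  have hi2 (j : κ) := integrable_norm_mul_norm f (h j)
  have hi3 : Integrable (fun p => ∑ j ∈ J, c j * (‖f p‖ * ‖h j p‖)) :=
    integrable_finsetSum _ fun j _ => (hi2 j).const_mul _
  have hmono : ∫ p, ⟪u p, u' p⟫_ℝ ≤
      ∫ p, (⟪f p, Complex.I * derivX (derivY f) p⟫_ℝ + ∑ j ∈ J, c j * (‖f p‖ * ‖h j p‖)) := by
    refine integral_mono_ae (L2.integrable_inner _ _) (hi1.add hi3) ?_
    filter_upwards [hu, hu'] with p h1 h2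
    rw [h1, h2, inner_add_right, inner_sub_right]
    have hw : ⟪f p, Complex.I * (w p : ℂ) * f p⟫_ℝ = 0 := by
      simp only [Complex.inner]; simp; ring
    have hFp : ⟪f p, F p⟫_ℝ ≤ ∑ j ∈ J, c j * (‖f p‖ * ‖h j p‖) := by
      refine (real_inner_le_norm _ _).trans ?_
      refine (mul_le_mul_of_nonneg_left (hF p) (norm_nonneg _)).trans_eq ?_
      rw [Finset.mul_sum]
      exact Finset.sum_congr rfl fun j _ => by ring
    rw [hw, sub_zero]
    exact add_le_add_right hFp _
  rw [integral_add hi1 hi3, integral_inner_I_mul_derivX_derivY, zero_add,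
    integral_finsetSum _ fun j _ => (hi2 j).const_mul _] at hmono
  rw [L2.inner_def, hnorm, Finset.mul_sum]
  refine hmono.trans (Finset.sum_le_sum fun j hj => ?_)
  rw [integral_const_mul, mul_left_comm]
  exact mul_le_mul_of_nonneg_left (integral_norm_mul_norm_le _ _) (hc j hj)

end SchwartzPlane

section Potential

lemma supN_nonneg (f : ℝ → ℝ) : 0 ≤ supN f := Real.iSup_nonneg fun _ => abs_nonneg _

lemma abs_le_supN {f : ℝ → ℝ} (h : ∃ C : ℝ, ∀ x, |f x| ≤ C) (x : ℝ) : |f x| ≤ supN f := by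
  obtain ⟨C, hC⟩ := h
  exact le_ciSup (f := fun x => |f x|) ⟨C, by rintro _ ⟨y, rfl⟩; exact hC y⟩ x

/-- A member of a finite family of nonnegative reals is at most the supremum of the family. -/
lemma le_iSup_mem_finset (s : Finset ℕ) {f : ℕ → ℝ} (hf : ∀ n, 0 ≤ f n) {n : ℕ} (hn : n ∈ s) :
    f n ≤ ⨆ n ∈ s, f n := by
  have hb : BddAbove (Set.range fun n => ⨆ _ : n ∈ s, f n) := by
    refine ⟨∑ m ∈ s, f m, ?_⟩
    rintro _ ⟨m, rfl⟩
    refine Real.iSup_le (fun hm => ?_) (Finset.sum_nonneg fun m _ => hf m)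
    exact Finset.single_le_sum (fun m _ => hf m) hm
  refine le_trans ?_ (le_ciSup hb n)
  simp [hn]

lemma iteratedDeriv_ofReal_comp {f : ℝ → ℝ} {m : ℕ} (hf : ContDiff ℝ m f) {n : ℕ} (hn : n ≤ m) :
    iteratedDeriv n (fun x => (f x : ℂ)) = fun x => ((iteratedDeriv n f x : ℝ) : ℂ) := by
  induction n with
  | zero => simp
  | succ n ih =>
    rw [iteratedDeriv_succ, ih (by lia)]
    funext x
    have hd : DifferentiableAt ℝ (iteratedDeriv n f) x :=
      hf.differentiable_iteratedDeriv n (by exact_mod_cast hn) x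
    rw [iteratedDeriv_succ]
    exact hd.hasDerivAt.ofReal_comp.deriv

/-- The symmetric difference quotient of `V` is `V'` up to a cubic error. -/
lemma abs_sub_sub_two_mul_deriv_le {V : ℝ → ℝ} (hV : ContDiff ℝ 3 V) {B : ℝ}
    (hB : ∀ x, |iteratedDeriv 3 V x| ≤ B) (x h : ℝ) :
    |V (x + h) - V (x - h) - 2 * h * deriv V x| ≤ B * |h| ^ 3 / 3 := by
  wlog hh : 0 ≤ h generalizing h
  · have := this (-h) (by linarith)
    rw [abs_neg, sub_neg_eq_add, ← sub_eq_add_neg] at this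
    rw [← abs_neg]
    convert this using 2
    ring
  have h1 (z : ℝ) : HasDerivAt V (deriv V z) z := (hV.differentiable (by norm_num) z).hasDerivAt
  have h2 (z : ℝ) : HasDerivAt (deriv V) (iteratedDeriv 2 V z) z := by
    have := hV.differentiable_iteratedDeriv 1 (by norm_num) z
    rw [iteratedDeriv_succ, iteratedDeriv_one]
    rw [iteratedDeriv_one] at this
    exact this.hasDerivAt
  have h3 (z : ℝ) : HasDerivAt (iteratedDeriv 2 V) (iteratedDeriv 3 V z) z := by
    have := hV.differentiable_iteratedDeriv 2 (by norm_num) z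
    rw [iteratedDeriv_succ (n := 2)]
    exact this.hasDerivAt
  have ha (s : ℝ) : HasDerivAt (fun s => x + s) 1 s := (hasDerivAt_id s).const_add x
  have hs (s : ℝ) : HasDerivAt (fun s => x - s) (-1) s := (hasDerivAt_id s).const_sub x
  have bound {f f' B B' : ℝ → ℝ} (hf : ∀ s, HasDerivAt f (f' s) s) (hB : ∀ s, HasDerivAt B (B' s) s)
      (h0 : |f 0| ≤ B 0) (hle : ∀ s, 0 ≤ s → |f' s| ≤ B' s) (s : ℝ) (hs : 0 ≤ s) : |f s| ≤ B s :=
    image_norm_le_of_norm_deriv_right_le_deriv_boundary (a := 0) (b := s)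
      (fun z _ => (hf z).continuousAt.continuousWithinAt) (fun z _ => (hf z).hasDerivWithinAt)
      h0 hB (fun z hz => hle z hz.1) ⟨hs, le_rfl⟩
  have b2 := bound (f := fun s => iteratedDeriv 2 V (x + s) - iteratedDeriv 2 V (x - s))
    (B := fun s => 2 * B * s)
    (fun s => ((h3 (x + s)).comp s (ha s)).sub ((h3 (x - s)).comp s (hs s)))
    (fun s => (hasDerivAt_id s).const_mul (2 * B)) (by simp) (fun s _ => by
      have e1 := abs_le.1 (hB (x + s))
      have e2 := abs_le.1 (hB (x - s))
      exact abs_le.2 ⟨by linarith [e1.1, e2.1], by linarith [e1.2, e2.2]⟩)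
  have b1 := bound (f := fun s => deriv V (x + s) + deriv V (x - s) - 2 * deriv V x)
    (B := fun s => B * s ^ 2)
    (fun s => (((h2 (x + s)).comp s (ha s)).add ((h2 (x - s)).comp s (hs s))).sub_const _)
    (fun s => (hasDerivAt_pow 2 s).const_mul B) (by simp; ring_nf) (fun s hs0 => by
      convert b2 s hs0 using 1
      · congr 1; ring
      · push_cast; ring)
  have b0 := bound (f := fun s => V (x + s) - V (x - s) - 2 * s * deriv V x)
    (B := fun s => B * s ^ 3 / 3)
    (fun s => (((h1 (x + s)).comp s (ha s)).sub ((h1 (x - s)).comp s (hs s))).sub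
      (((hasDerivAt_id s).const_mul 2).mul_const _))
    (fun s => ((hasDerivAt_pow 3 s).const_mul B).div_const 3) (by simp) (fun s hs0 => by
      convert b1 s hs0 using 1
      · congr 1; ring
      · push_cast; ring)
  simpa [abs_of_nonneg hh] using b0 h hh

lemma abs_Eh_le {hbar : ℝ} (hh : 0 < hbar) {V : ℝ → ℝ} (hV : ContDiff ℝ 3 V) {B : ℝ}
    (hB : ∀ x, |iteratedDeriv 3 V x| ≤ B) (x y : ℝ) :
    |Eh hbar V x y| ≤ hbar ^ 2 / 24 * B * |y| ^ 3 := by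
  have h := abs_sub_sub_two_mul_deriv_le hV hB x (hbar * y / 2)
  have he : Eh hbar V x y =
      (V (x + hbar * y / 2) - V (x - hbar * y / 2) - 2 * (hbar * y / 2) * deriv V x) / hbar := by
    rw [Eh]; field_simp
  rw [he, abs_div, abs_of_pos hh, div_le_iff₀ hh]
  refine h.trans_eq ?_
  rw [abs_div, abs_mul, abs_of_pos hh, abs_of_pos (two_pos : (0 : ℝ) < 2)]
  ring

end Potential

section Transfer

lemma IsSchwartz2.exists_schwartzMap {f : ℝ → ℝ → ℂ} (hf : IsSchwartz2 f) :
    ∃ s : 𝓢(ℝ × ℝ, ℂ), f = fun x y => s (x, y) :=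
  ⟨⟨unc f, hf.1, hf.2⟩, rfl⟩

lemma pd2_one_one (s : 𝓢(ℝ × ℝ, ℂ)) (x y : ℝ) :
    pd2 1 1 (fun x y => s (x, y)) x y = derivX (derivY s) (x, y) := by
  simp only [pd2, iteratedDeriv_one, (hasDerivAt_slice_snd s _ _).deriv]
  exact (hasDerivAt_slice_fst _ _ _).deriv

lemma wD_eq_weightedX (α b : ℕ) (s : 𝓢(ℝ × ℝ, ℂ)) :
    unc (wD 0 b α 0 (fun x y => s (x, y))) = weightedX α b s := by
  ext ⟨x, y⟩
  simp [unc, wD, pd2, iteratedDeriv_slice_fst, weightedX_apply]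

lemma L2_wD (α b : ℕ) (s : 𝓢(ℝ × ℝ, ℂ)) :
    L2 (wD 0 b α 0 (fun x y => s (x, y))) = ‖(weightedX α b s).toLp 2‖ := by
  rw [L2, wD_eq_weightedX, SchwartzMap.norm_toLp]

/-- Leibniz expansion of `y^α ∂_x^b` applied to the semiclassical generator. -/
lemma wD_semiclassical {V : ℝ → ℝ} (hV : ContDiff ℝ 4 V) (s : 𝓢(ℝ × ℝ, ℂ)) (α : ℕ) {b : ℕ}
    (hb : b ≤ 3) (x y : ℝ) :
    wD 0 b α 0 (fun x y => Complex.I * derivX (derivY s) (x, y) -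
        Complex.I * ((deriv V x * y : ℝ) : ℂ) * s (x, y)) x y =
      Complex.I * derivX (derivY (weightedX α b s)) (x, y) -
        Complex.I * ((deriv V x * y : ℝ) : ℂ) * weightedX α b s (x, y) +
        (-(Complex.I * (α * weightedX (α - 1) (b + 1) s (x, y))) -
          Complex.I * ∑ i ∈ Finset.range b, (b.choose (i + 1) : ℂ) *
            ((iteratedDeriv (i + 2) V x : ℝ) : ℂ) * weightedX (α + 1) (b - (i + 1)) s (x, y)) := by
  have hV' : ContDiff ℝ 3 (deriv V) := by
    have h4 : ContDiff ℝ (3 + 1) V := by norm_num; exact hV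
    exact (contDiff_succ_iff_deriv.1 h4).2.2
  have hVc : ContDiff ℝ b (fun x => ((deriv V x : ℝ) : ℂ)) :=
    Complex.ofRealCLM.contDiff.comp (hV'.of_le (by exact_mod_cast hb))
  have hfun : (fun x => Complex.I * derivX (derivY s) (x, y) -
      Complex.I * ((deriv V x * y : ℝ) : ℂ) * s (x, y)) =
      fun x => Complex.I * derivX (derivY s) (x, y) -
        (Complex.I * y) * (((deriv V x : ℝ) : ℂ) * s (x, y)) := by
    funext x; push_cast; ring
  have hc1 := (contDiff_slice_fst (derivX (derivY s)) b y)
  have hc2 := hVc.mul (contDiff_slice_fst s b y)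
  have hleib := iteratedDeriv_fun_mul (n := b) (x := x) hVc.contDiffAt
    (contDiff_slice_fst s b y).contDiffAt
  simp only [wD, pd2, iteratedDeriv_zero, pow_zero, one_mul]
  rw [hfun, iteratedDeriv_fun_sub (contDiff_const.mul hc1).contDiffAt
    (contDiff_const.mul hc2).contDiffAt, iteratedDeriv_const_mul_field,
    iteratedDeriv_const_mul_field, hleib, Finset.sum_range_succ', iteratedDeriv_slice_fst,
    derivX_derivY_weightedX_apply]
  have hterm : ∀ i ∈ Finset.range b,
      (b.choose (i + 1) : ℂ) * iteratedDeriv (i + 1) (fun x => ((deriv V x : ℝ) : ℂ)) x *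
        iteratedDeriv (b - (i + 1)) (fun x => s (x, y)) x =
      (b.choose (i + 1) : ℂ) * ((iteratedDeriv (i + 2) V x : ℝ) : ℂ) *
        (derivX^[b - (i + 1)] s) (x, y) := by
    intro i hi
    rw [iteratedDeriv_ofReal_comp (m := 3) hV' (by have := Finset.mem_range.1 hi; lia),
      iteratedDeriv_slice_fst, iteratedDeriv_succ' (n := i + 1)]
  rw [Finset.sum_congr rfl hterm]
  have hsum : ∑ i ∈ Finset.range b, (b.choose (i + 1) : ℂ) *
      ((iteratedDeriv (i + 2) V x : ℝ) : ℂ) * weightedX (α + 1) (b - (i + 1)) s (x, y) =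
      (y : ℂ) ^ (α + 1) * ∑ i ∈ Finset.range b, (b.choose (i + 1) : ℂ) *
      ((iteratedDeriv (i + 2) V x : ℝ) : ℂ) * (derivX^[b - (i + 1)] s) (x, y) := by
    rw [Finset.mul_sum]
    exact Finset.sum_congr rfl fun i _ => by rw [weightedX_apply]; ring
  rw [hsum]
  simp only [weightedX_apply, iteratedDeriv_zero, Nat.choose_zero_right, Nat.cast_one, one_mul,
    Nat.sub_zero, iteratedDeriv_slice_fst]
  push_cast
  ring

end Transfer

section Growth

/-- The exponents `(α, b)` with `α + b ≤ 3`. -/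
def weightIndices : Finset (ℕ × ℕ) :=
  (Finset.range 4 ×ˢ Finset.range 4).filter fun q => q.1 + q.2 ≤ 3

lemma sum_weightIndices (f : ℕ × ℕ → ℝ) :
    ∑ q ∈ weightIndices, f q = f (0, 0) + f (0, 1) + f (0, 2) + f (0, 3) + f (1, 0) + f (1, 1) +
      f (1, 2) + f (2, 0) + f (2, 1) + f (3, 0) := by
  simp only [weightIndices, Finset.sum_filter, Finset.sum_product, Finset.sum_range_succ]
  norm_num
  ring

lemma L2_nonneg (f : ℝ → ℝ → ℂ) : 0 ≤ L2 f := ENNReal.toReal_nonneg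

lemma sum_L2_wD_le_NN (f : ℝ → ℝ → ℂ) :
    ∑ q ∈ weightIndices, L2 (wD 0 q.2 q.1 0 f) ≤ NN 3 f := by
  have hinj : Set.InjOn (fun q : ℕ × ℕ => ((0, q.2, q.1, 0) : ℕ × ℕ × ℕ × ℕ)) weightIndices := by
    rintro ⟨a, b⟩ - ⟨c, d⟩ - h
    simp_all
  rw [← Finset.sum_image (f := fun q : ℕ × ℕ × ℕ × ℕ => L2 (wD q.1 q.2.1 q.2.2.1 q.2.2.2 f)) hinj]
  exact Finset.sum_le_sum_of_subset_of_nonneg (by decide) fun _ _ _ => L2_nonneg _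

/-- The potential part of the constant `C_3[V]`. -/
def potentialBound (V : ℝ → ℝ) : ℝ := ⨆ n ∈ Finset.Icc 2 4, supN (iteratedDeriv n V)

lemma supN_le_potentialBound (V : ℝ → ℝ) {n : ℕ} (h2 : 2 ≤ n) (h4 : n ≤ 4) :
    supN (iteratedDeriv n V) ≤ potentialBound V :=
  le_iSup_mem_finset (Finset.Icc 2 4) (f := fun n => supN (iteratedDeriv n V))
    (fun _ => supN_nonneg _) (Finset.mem_Icc.2 ⟨h2, h4⟩)

lemma potentialBound_nonneg (V : ℝ → ℝ) : 0 ≤ potentialBound V :=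
  (supN_nonneg _).trans (supN_le_potentialBound V le_rfl (by norm_num))

lemma le_CmV_three (V : ℝ → ℝ) : 15 + 96 * potentialBound V ≤ CmV 3 V := by
  have h1 := supN_nonneg (iteratedDeriv 2 V)
  have h2 := abs_nonneg (deriv V 0)
  have h : CmV 3 V = ((3 : ℝ) ^ 2 + 2 * 3 + 3 * supN (iteratedDeriv 2 V) + 3 * |deriv V 0|) +
      2 ^ 3 * (1 + 3) * 3 * potentialBound V := by
    simp [CmV, potentialBound]
  rw [h]
  linarith

lemma CmV_three_pos (V : ℝ → ℝ) : 0 < CmV 3 V := by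
  linarith [le_CmV_three V, potentialBound_nonneg V]

/-- Energy inequality for `y^α ∂_x^b` of a solution of the semiclassical equation. -/
lemma inner_weighted_le {V : ℝ → ℝ} (hV : ContDiff ℝ 4 V)
    (hVb : ∀ n : ℕ, 2 ≤ n → n ≤ 4 → ∃ C : ℝ, ∀ x : ℝ, |iteratedDeriv n V x| ≤ C)
    (s : 𝓢(ℝ × ℝ, ℂ)) (α : ℕ) {b : ℕ} (hb : b ≤ 3)
    (u u' : Lp ℂ 2 (volume : Measure (ℝ × ℝ))) (hu : u =ᵐ[volume] weightedX α b s)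
    (hu' : u' =ᵐ[volume] unc (wD 0 b α 0 (fun x y => Complex.I * derivX (derivY s) (x, y) -
        Complex.I * ((deriv V x * y : ℝ) : ℂ) * s (x, y)))) :
    ⟪u, u'⟫_ℝ ≤ ‖u‖ * (α * ‖(weightedX (α - 1) (b + 1) s).toLp 2‖ +
      ∑ i ∈ Finset.range b, b.choose (i + 1) * potentialBound V *
        ‖(weightedX (α + 1) (b - (i + 1)) s).toLp 2‖) := by
  have hK := potentialBound_nonneg V
  refine (inner_le_of_ae_eq_generator (Finset.range (b + 1)) (weightedX α b s)
    (fun j => if j = 0 then weightedX (α - 1) (b + 1) s else weightedX (α + 1) (b - j) s)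
    (fun j => if j = 0 then (α : ℝ) else b.choose j * potentialBound V)
    (fun j _ => by split_ifs <;> positivity) (fun p => deriv V p.1 * p.2)
    (fun p => -(Complex.I * (α * weightedX (α - 1) (b + 1) s p)) -
          Complex.I * ∑ i ∈ Finset.range b, (b.choose (i + 1) : ℂ) *
            ((iteratedDeriv (i + 2) V p.1 : ℝ) : ℂ) * weightedX (α + 1) (b - (i + 1)) s p)
    u u' hu ?_ ?_).trans_eq ?_
  · refine hu'.trans (Filter.Eventually.of_forall fun p => ?_)
    exact wD_semiclassical hV s α hb p.1 p.2
  · intro p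
    rw [Finset.sum_range_succ']
    refine (norm_sub_le _ _).trans ?_
    rw [add_comm]
    refine add_le_add ?_ (by simp)
    rw [norm_mul, Complex.norm_I, one_mul]
    refine (norm_sum_le _ _).trans (Finset.sum_le_sum fun i hi => ?_)
    have hi' := Finset.mem_range.1 hi
    have h2 : |iteratedDeriv (i + 2) V p.1| ≤ potentialBound V :=
      (abs_le_supN (hVb _ (by lia) (by lia)) _).trans
        (supN_le_potentialBound V (by lia) (by lia))
    simp only [Nat.succ_ne_zero, if_false, norm_mul, Complex.norm_real, Complex.norm_natCast,
      Real.norm_eq_abs]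
    gcongr
  · rw [Finset.sum_range_succ', add_comm]
    simp

lemma sum_weightIndices_source_le {n : ℕ × ℕ → ℝ} (hn : ∀ q, 0 ≤ n q) {K C : ℝ} (hK : 0 ≤ K)
    (hC : 15 + 96 * K ≤ C) :
    ∑ q ∈ weightIndices, ((q.1 : ℝ) * n (q.1 - 1, q.2 + 1) +
      ∑ i ∈ Finset.range q.2, (q.2.choose (i + 1) : ℝ) * K * n (q.1 + 1, q.2 - (i + 1))) ≤
      C * ∑ q ∈ weightIndices, n q := by
  have hsum : 0 ≤ ∑ q ∈ weightIndices, n q := Finset.sum_nonneg fun q _ => hn q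
  refine le_trans ?_ (mul_le_mul_of_nonneg_right hC hsum)
  have hKn q : 0 ≤ K * n q := mul_nonneg hK (hn q)
  rw [sum_weightIndices, sum_weightIndices]
  simp [Finset.sum_range_succ, Nat.choose]
  linarith [hn (0, 0), hn (0, 1), hn (0, 2), hn (0, 3), hn (1, 0), hn (1, 1), hn (1, 2),
    hn (2, 0), hn (2, 1), hn (3, 0), hKn (0, 0), hKn (0, 1), hKn (0, 2), hKn (0, 3), hKn (1, 0),
    hKn (1, 1), hKn (1, 2), hKn (2, 0), hKn (2, 1), hKn (3, 0)]

/-- Exponential growth bound for the norms of `y^α ∂_x^b 𝒮`, `α + b ≤ 3`, along a solution of the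
semiclassical equation. -/
lemma sum_weighted_le_exp {V : ℝ → ℝ} (hV : ContDiff ℝ 4 V)
    (hVb : ∀ n : ℕ, 2 ≤ n → n ≤ 4 → ∃ C : ℝ, ∀ x : ℝ, |iteratedDeriv n V x| ≤ C)
    {S : ℝ → ℝ → ℝ → ℂ} (hS : IsSCSol V S) {t : ℝ} (ht : 0 ≤ t) :
    ∑ q ∈ weightIndices, L2 (wD 0 q.2 q.1 0 (S t)) ≤
      Real.exp (CmV 3 V * t) * ∑ q ∈ weightIndices, L2 (wD 0 q.2 q.1 0 (S 0)) := by
  obtain ⟨⟨-, hsch, hC1⟩, heq⟩ := hS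
  choose! s hs using fun t ht => (hsch t ht).exists_schwartzMap
  choose u u' hu hu' hder _ using fun q : ℕ × ℕ => hC1 0 q.2 q.1 0
  have hdt {t : ℝ} (ht : 0 ≤ t) : dtR S t = fun x y => Complex.I * derivX (derivY (s t)) (x, y) -
      Complex.I * ((deriv V x * y : ℝ) : ℂ) * s t (x, y) := by
    funext x y
    rw [heq t ht, hs t ht, pd2_one_one]
  have hue (q : ℕ × ℕ) {t : ℝ} (ht : 0 ≤ t) : u q t =ᵐ[volume] weightedX q.1 q.2 (s t) := by
    rw [← wD_eq_weightedX, ← hs t ht]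
    exact hu q t ht
  have hnorm (q : ℕ × ℕ) {t : ℝ} (ht : 0 ≤ t) :
      ‖u q t‖ = ‖(weightedX q.1 q.2 (s t)).toLp 2‖ := by
    rw [Lp.norm_def, SchwartzMap.norm_toLp, eLpNorm_congr_ae (hue q ht)]
  have hL2 (q : ℕ × ℕ) {t : ℝ} (ht : 0 ≤ t) : L2 (wD 0 q.2 q.1 0 (S t)) = ‖u q t‖ := by
    rw [hnorm q ht, hs t ht, L2_wD]
  simp only [hL2 _ ht, hL2 _ le_rfl]
  refine sum_norm_le_exp_mul weightIndices u u'
    (fun q t => q.1 * ‖(weightedX (q.1 - 1) (q.2 + 1) (s t)).toLp 2‖ +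
      ∑ i ∈ Finset.range q.2, q.2.choose (i + 1) * potentialBound V *
        ‖(weightedX (q.1 + 1) (q.2 - (i + 1)) (s t)).toLp 2‖)
    (CmV_three_pos V).le (fun q _ => hder q) ?_ ?_ ?_ ht
  · intro q _ r _
    have hK := potentialBound_nonneg V
    positivity
  · intro q hq r hr
    have hq2 : q.2 ≤ 3 := by
      have := (Finset.mem_filter.1 hq).2
      lia
    have hur := hu' q r hr
    rw [hdt hr] at hur
    exact inner_weighted_le hV hVb (s r) q.1 hq2 _ _ (hue q hr) hur
  · intro r hr
    simp only [hnorm _ hr]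
    exact sum_weightIndices_source_le (n := fun q => ‖(weightedX q.1 q.2 (s r)).toLp 2 volume‖)
      (fun _ => norm_nonneg _) (potentialBound_nonneg V) (le_CmV_three V)

end Growth

/-- Energy inequality for the difference of a von Neumann and a semiclassical solution. -/
lemma inner_error_le {hbar : ℝ} (hh : 0 < hbar) {V : ℝ → ℝ} (hV : ContDiff ℝ 3 V) {B : ℝ}
    (hB : ∀ x, |iteratedDeriv 3 V x| ≤ B) (r s : 𝓢(ℝ × ℝ, ℂ))
    (u u' : Lp ℂ 2 (volume : Measure (ℝ × ℝ))) (hu : u =ᵐ[volume] fun p => r p - s p)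
    (hu' : u' =ᵐ[volume] fun p =>
      (Complex.I * derivX (derivY r) p - Complex.I *
        (((V (p.1 + hbar * p.2 / 2) - V (p.1 - hbar * p.2 / 2)) / hbar : ℝ) : ℂ) * r p) -
      (Complex.I * derivX (derivY s) p - Complex.I * ((deriv V p.1 * p.2 : ℝ) : ℂ) * s p)) :
    ⟪u, u'⟫_ℝ ≤ ‖u‖ * (hbar ^ 2 / 24 * B * ‖(weightedX 3 0 s).toLp 2‖) := by
  have hB0 : 0 ≤ B := (abs_nonneg _).trans (hB 0)
  have hsub : derivX (derivY (r - s)) = derivX (derivY r) - derivX (derivY s) := by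
    simp only [derivX, derivY, sub_eq_add_neg, LineDeriv.lineDerivOp_add, LineDeriv.lineDerivOp_neg]
  refine (inner_le_of_ae_eq_generator {()} (r - s) (fun _ => weightedX 3 0 s)
    (fun _ => hbar ^ 2 / 24 * B) (fun _ _ => by positivity)
    (fun p => (V (p.1 + hbar * p.2 / 2) - V (p.1 - hbar * p.2 / 2)) / hbar)
    (fun p => -(Complex.I * (Eh hbar V p.1 p.2 : ℂ) * s p)) u u' hu ?_ ?_).trans_eq (by simp)
  · refine hu'.trans (Filter.Eventually.of_forall fun p => ?_)
    simp only [hsub, sub_apply, Eh]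
    push_cast
    ring
  · rintro ⟨x, y⟩
    simp only [Finset.sum_singleton, weightedX_apply, norm_neg, norm_mul, Complex.norm_I, one_mul,
      norm_pow, Complex.norm_real, Real.norm_eq_abs, Function.iterate_zero, id]
    rw [← mul_assoc]
    exact mul_le_mul_of_nonneg_right (abs_Eh_le hh hV hB x y) (norm_nonneg _)

/-- Semiclassical limit error estimate (Theorem 1.2). -/
theorem semiclassical_limit_error (hbar : ℝ) (hh : 0 < hbar) (V : ℝ → ℝ)
    (hV : ContDiff ℝ 4 V)
    (hVb : ∀ n : ℕ, 2 ≤ n → n ≤ 4 → ∃ C : ℝ, ∀ x : ℝ, |iteratedDeriv n V x| ≤ C)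
    (R S : ℝ → ℝ → ℝ → ℂ) (hR : IsVNSol hbar V R) (hS : IsSCSol V S) :
    ∀ t : ℝ, 0 ≤ t →
      L2 (fun x y => R t x y - S t x y) ≤
        L2 (fun x y => R 0 x y - S 0 x y) +
          hbar^2 / 24 * supN (iteratedDeriv 3 V) *
            ((Real.exp (CmV 3 V * t) - 1) / CmV 3 V) * NN 3 (S 0) := by
  obtain ⟨⟨-, hRsch, hRC1⟩, hReq⟩ := hR
  obtain ⟨⟨-, hSsch, hSC1⟩, hSeq⟩ := id hS
  choose! r hr using fun t ht => (hRsch t ht).exists_schwartzMap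
  choose! s hs using fun t ht => (hSsch t ht).exists_schwartzMap
  obtain ⟨u, u', hu, hu', hud, -⟩ := hRC1 0 0 0 0
  obtain ⟨v, v', hv, hv', hvd, -⟩ := hSC1 0 0 0 0
  have hw0 (f : ℝ → ℝ → ℂ) : unc (wD 0 0 0 0 f) = unc f := by
    ext p
    simp [unc, wD, pd2]
  have hB := abs_le_supN (hVb 3 (by norm_num) (by norm_num))
  have hdiff {t : ℝ} (ht : 0 ≤ t) : (u - v) t =ᵐ[volume] fun p => r t p - s t p := by
    have h1 := hu t ht
    have h2 := hv t ht
    rw [hw0, hr t ht] at h1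
    rw [hw0, hs t ht] at h2
    filter_upwards [h1, h2, Lp.coeFn_sub (u t) (v t)] with p h1 h2 h3
    rw [Pi.sub_apply, h3, Pi.sub_apply, h1, h2]
    rfl
  have hL2 {t : ℝ} (ht : 0 ≤ t) : L2 (fun x y => R t x y - S t x y) = ‖(u - v) t‖ := by
    rw [L2, Lp.norm_def, eLpNorm_congr_ae (hdiff ht), hr t ht, hs t ht]
    rfl
  have hcube {t : ℝ} (ht : 0 ≤ t) :
      ‖(weightedX 3 0 (s t)).toLp 2‖ ≤ Real.exp (CmV 3 V * t) * NN 3 (S 0) := by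
    rw [← L2_wD, ← hs t ht]
    calc L2 (wD 0 0 3 0 (S t)) ≤ ∑ q ∈ weightIndices, L2 (wD 0 q.2 q.1 0 (S t)) :=
          Finset.single_le_sum (f := fun q : ℕ × ℕ => L2 (wD 0 q.2 q.1 0 (S t)))
            (a := (3, 0)) (fun _ _ => L2_nonneg _) (by decide)
      _ ≤ _ := sum_weighted_le_exp hV hVb hS ht
      _ ≤ _ := mul_le_mul_of_nonneg_left (sum_L2_wD_le_NN _) (Real.exp_pos _).le
  intro t ht
  have hK : 0 ≤ hbar ^ 2 / 24 * supN (iteratedDeriv 3 V) := by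
    have := supN_nonneg (iteratedDeriv 3 V)
    positivity
  have hNN : 0 ≤ NN 3 (S 0) := Finset.sum_nonneg fun _ _ => L2_nonneg _
  have main := norm_le_add_of_inner_le_exp (u := u - v) (u' := u' - v') (CmV_three_pos V)
    (mul_nonneg hK hNN) (fun t ht => (hud t ht).sub (hvd t ht)) (fun t ht => by
      have h1 := hu' t ht
      have h2 := hv' t ht
      rw [hw0] at h1 h2
      refine (inner_error_le hh (hV.of_le (by norm_num)) hB (r t) (s t) _ _ (hdiff ht) ?_).trans
        (mul_le_mul_of_nonneg_left ?_ (norm_nonneg _))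
      · filter_upwards [h1, h2, Lp.coeFn_sub (u' t) (v' t)] with p h1 h2 h3
        rw [Pi.sub_apply, h3, Pi.sub_apply, h1, h2, unc, unc, hReq t ht, hSeq t ht, hr t ht,
          hs t ht, pd2_one_one, pd2_one_one]
      · refine (mul_le_mul_of_nonneg_left (hcube ht) hK).trans_eq ?_
        ring) ht
  rw [hL2 ht, hL2 le_rfl]
  refine main.trans_eq ?_
  ring

end
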